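/- Attainability part of Theorem 2. Under the sample selection model with Assumptions 1 and 3, integrable Y₀*, Y₁*, continuous strictly increasing conditional CDF F₁ of Y given {D=1, S=1} with density f¹, the positivity conditions, and Assumption 4 (tail smoothness: f¹(y¹_{ϑq₀/2} − a) ≤ f¹(y¹_{ϑq₀/2} + a) and f¹(y¹_{1−ϑq₀/2} − a) ≥ f¹(y¹_{1−ϑq₀/2} + a) for all a ≥ 0), the symmetry bounds are attainable: there exist, on some probability space, random variables (Ỹ₁*, Ỹ₀*, S̃₁, S̃₀, D̃) satisfying the model equations, Assumptions 1, 3 and the symmetry Assumption 5 for the always-takers, whose induced observables (Ỹ, S̃, D̃) have the same joint distribution as (Y, S, D), and whose parameter τ̃ equals the upper bound ∇̄ˢ := y¹_{1−ϑq₀/2} − E[Y | D=0, S=1]; and likewise a configuration with τ̃ equal to the lower bound ∇̲ˢ := y¹_{ϑq₀/2} − E[Y | D=0, S=1]. -/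

import Mathlib

noncomputable section

/-- Probability of an event as a real number. -/
def pr {Ω : Type*} [MeasurableSpace Ω] (μ : MeasureTheory.Measure Ω) (A : Set Ω) : ℝ :=
  (μ A).toReal

/-- Conditional probability `P(B | A)`. -/
def cpr {Ω : Type*} [MeasurableSpace Ω] (μ : MeasureTheory.Measure Ω) (A B : Set Ω) : ℝ :=
  pr μ (A ∩ B) / pr μ A

/-- Conditional expectation of `X` given the event `A`. -/
def cexp {Ω : Type*} [MeasurableSpace Ω] (μ : MeasureTheory.Measure Ω) (X : Ω → ℝ)
    (A : Set Ω) : ℝ :=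
  (∫ ω in A, X ω ∂μ) / pr μ A

/-- A sample-selection configuration: a probability space carrying potential outcomes,
potential selection indicators and a treatment indicator satisfying the model
equations, Assumption 1 (independent assignment) and Assumption 3 (stochastic
monotonicity with parameter `ϑL`).
In addition, the conditional distribution of `Y1'` for always-takers has a symmetric
Lebesgue density (Assumption 5). -/
structure SelectionConfig (ϑL : ℝ) : Type 1 where
  carrier : Type
  [inst : MeasurableSpace carrier]
  μ' : MeasureTheory.Measure carrier
  prob : MeasureTheory.IsProbabilityMeasure μ'
  Y1' : carrier → ℝ
  Y0' : carrier → ℝ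
  S1' : carrier → ℝ
  S0' : carrier → ℝ
  D' : carrier → ℝ
  S' : carrier → ℝ
  Y' : carrier → ℝ
  meas_Y1 : Measurable Y1'
  meas_Y0 : Measurable Y0'
  meas_S1 : Measurable S1'
  meas_S0 : Measurable S0'
  meas_D : Measurable D'
  vals_S1 : ∀ ω, S1' ω = 0 ∨ S1' ω = 1
  vals_S0 : ∀ ω, S0' ω = 0 ∨ S0' ω = 1
  vals_D : ∀ ω, D' ω = 0 ∨ D' ω = 1
  hS' : ∀ ω, S' ω = S1' ω * D' ω + S0' ω * (1 - D' ω)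
  hY' : ∀ ω, Y' ω = S' ω * (Y1' ω * D' ω + Y0' ω * (1 - D' ω))
  int_Y1 : MeasureTheory.Integrable Y1' μ'
  int_Y0 : MeasureTheory.Integrable Y0' μ'
  indep : ProbabilityTheory.IndepFun (fun ω => (Y1' ω, Y0' ω, S1' ω, S0' ω)) D' μ'
  sm1 : ϑL ≤ cpr μ' {ω | S0' ω = 1} {ω | S1' ω = 1}
  sm2 : ProbabilityTheory.IndepFun (fun ω => (Y1' ω, Y0' ω)) S1'
          (ProbabilityTheory.cond μ' {ω | S0' ω = 1})
  symm : ∃ (f : ℝ → ℝ) (mc : ℝ),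
    (MeasureTheory.Measure.map Y1' (ProbabilityTheory.cond μ' {ω | S0' ω = 1 ∧ S1' ω = 1})
        = MeasureTheory.Measure.withDensity MeasureTheory.volume
            fun x => ENNReal.ofReal (f x)) ∧
      ∀ x : ℝ, f (mc + x) = f (mc - x)

attribute [instance] SelectionConfig.inst

open MeasureTheory ProbabilityTheory Set

variable {Ω : Type*} [MeasurableSpace Ω]


namespace LeeAux

theorem law_apply {Ω : Type*} [MeasurableSpace Ω] (μ : Measure Ω) (Y S D : Ω → ℝ)
    (hY : Measurable Y) (hS : Measurable S) (hD : Measurable D) (vS : ∀ ω, S ω = 0 ∨ S ω = 1)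
    (vD : ∀ ω, D ω = 0 ∨ D ω = 1) (B : Set (ℝ × ℝ × ℝ)) (hB : MeasurableSet B) :
    Measure.map (fun ω => (Y ω, S ω, D ω)) μ B =
      (μ {ω | Y ω ∈ {y | (y, (1:ℝ), (1:ℝ)) ∈ B} ∧ S ω = 1 ∧ D ω = 1} +
        μ {ω | Y ω ∈ {y | (y, (1:ℝ), (0:ℝ)) ∈ B} ∧ S ω = 1 ∧ D ω = 0}) +
      (μ {ω | Y ω ∈ {y | (y, (0:ℝ), (1:ℝ)) ∈ B} ∧ S ω = 0 ∧ D ω = 1} +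
        μ {ω | Y ω ∈ {y | (y, (0:ℝ), (0:ℝ)) ∈ B} ∧ S ω = 0 ∧ D ω = 0}) := by
  have hm : Measurable (fun ω => (Y ω, S ω, D ω)) := hY.prodMk (hS.prodMk hD)
  rw [Measure.map_apply hm hB]
  have h1 : MeasurableSet {ω | S ω = 1} := hS (measurableSet_singleton 1)
  have h2 : MeasurableSet {ω | D ω = 1} := hD (measurableSet_singleton 1)
  set C := (fun ω => (Y ω, S ω, D ω)) ⁻¹' B with hC
  rw [← measure_inter_add_sdiff C h1, ← measure_inter_add_sdiff (C ∩ {ω | S ω = 1}) h2,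
    ← measure_inter_add_sdiff (C \ {ω | S ω = 1}) h2, hC]
  refine congrArg₂ _ (congrArg₂ _ ?_ ?_) (congrArg₂ _ ?_ ?_) <;> congr 1 <;> ext ω <;>
    rcases vS ω with a | a <;> rcases vD ω with b | b <;> simp [a, b]


theorem law_eq {Ω Ω' : Type*} [MeasurableSpace Ω] [MeasurableSpace Ω']
    (μ : Measure Ω) (μ' : Measure Ω') (Y S D : Ω → ℝ) (Y' S' D' : Ω' → ℝ)
    (hY : Measurable Y) (hS : Measurable S) (hD : Measurable D)
    (hY' : Measurable Y') (hS' : Measurable S') (hD' : Measurable D')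
    (vS : ∀ ω, S ω = 0 ∨ S ω = 1) (vD : ∀ ω, D ω = 0 ∨ D ω = 1)
    (vS' : ∀ ω, S' ω = 0 ∨ S' ω = 1) (vD' : ∀ ω, D' ω = 0 ∨ D' ω = 1)
    (h : ∀ A : Set ℝ, MeasurableSet A → ∀ s d : ℝ, (s = 0 ∨ s = 1) → (d = 0 ∨ d = 1) →
      μ' {ω | Y' ω ∈ A ∧ S' ω = s ∧ D' ω = d} = μ {ω | Y ω ∈ A ∧ S ω = s ∧ D ω = d}) :
    Measure.map (fun ω => (Y' ω, S' ω, D' ω)) μ' = Measure.map (fun ω => (Y ω, S ω, D ω)) μ := by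
  refine Measure.ext fun B hB => ?_
  have hB' : ∀ s d : ℝ, MeasurableSet {y : ℝ | (y, s, d) ∈ B} := fun s d =>
    (measurable_id.prodMk measurable_const : Measurable fun y : ℝ => (y, s, d)) hB
  rw [law_apply μ Y S D hY hS hD vS vD B hB, law_apply μ' Y' S' D' hY' hS' hD' vS' vD' B hB,
    h _ (hB' _ _) 1 1 (Or.inr rfl) (Or.inr rfl), h _ (hB' _ _) 1 0 (Or.inr rfl) (Or.inl rfl),
    h _ (hB' _ _) 0 1 (Or.inl rfl) (Or.inr rfl), h _ (hB' _ _) 0 0 (Or.inl rfl) (Or.inl rfl)]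

theorem sym_lemma (ν : Measure ℝ) [IsProbabilityMeasure ν] (f1 : ℝ → ℝ)
    (hf1 : ν = volume.withDensity fun x => ENNReal.ofReal (f1 x)) (m σ : ℝ) (hσ : σ * σ = 1)
    (htail : ∀ a : ℝ, 0 ≤ a → f1 (m - σ * a) ≤ f1 (m + σ * a)) :
    ∃ (l : Measure ℝ) (f : ℝ → ℝ), l ≤ ν ∧ l univ = 2 * ν {x | σ * (x - m) ≤ 0} ∧
      l = volume.withDensity (fun x => ENNReal.ofReal (f x)) ∧ Measurable f ∧
      (∀ x, f (m + x) = f (m - x)) ∧ Measure.map (fun x => 2 * m - x) l = l := by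
  have hac : ν ≪ volume := by rw [hf1]; exact withDensity_absolutelyContinuous _ _
  obtain ⟨h, hhm, hh⟩ : ∃ h : ℝ → ℝ, Measurable h ∧
      ν = volume.withDensity fun x => ENNReal.ofReal (h x) := by
    refine ⟨fun x => (ν.rnDeriv volume x).toReal, (Measure.measurable_rnDeriv _ _).ennreal_toReal, ?_⟩
    conv_lhs => rw [← Measure.withDensity_rnDeriv_eq ν volume hac]
    apply withDensity_congr_ae
    filter_upwards [Measure.rnDeriv_lt_top ν volume] with x hx
    rw [ENNReal.ofReal_toReal hx.ne]
  have hσ' : σ = 1 ∨ σ = -1 := mul_self_eq_one_iff.mp hσ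
  -- reflection
  let e : ℝ ≃ᵐ ℝ := (Homeomorph.subLeft (2 * m)).toMeasurableEquiv
  have he : ∀ x, e x = 2 * m - x := fun x => rfl
  have hmp : MeasurePreserving e volume volume := Measure.measurePreserving_sub_left volume (2 * m)
  have hrefl : ∀ (u : ℝ → ENNReal) (A : Set ℝ), MeasurableSet A →
      ∫⁻ x in A, u (2 * m - x) = ∫⁻ x in e ⁻¹' A, u x := by
    intro u A hA
    have hinv : e ⁻¹' (e ⁻¹' A) = A := by ext x; simp [he]
    have := hmp.setLIntegral_comp_preimage_emb e.measurableEmbedding u (e ⁻¹' A)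
    rw [hinv] at this
    exact this
  let f : ℝ → ℝ := fun x => h (m - σ * |x - m|)
  have hfm : Measurable f := hhm.comp (by fun_prop)
  have hfs : ∀ x, f (2 * m - x) = f x := by
    intro x
    simp only [f]
    rw [show 2 * m - x - m = -(x - m) by ring, abs_neg]
  let T : Set ℝ := {x | σ * (x - m) ≤ 0}
  have hT : MeasurableSet T := measurableSet_le (by fun_prop) measurable_const
  let l : Measure ℝ := volume.withDensity (fun x => ENNReal.ofReal (f x))
  have hfT : ∀ x ∈ T, f x = h x := by
    intro x hx
    simp only [f]
    have hx' : σ * (x - m) ≤ 0 := hx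
    congr 1
    rcases hσ' with r | r <;> subst r
    · rw [abs_of_nonpos (by linarith)]; ring
    · rw [abs_of_nonneg (by linarith)]; ring
  have hA1 : ∀ A, MeasurableSet A → l (A ∩ T) = ν (A ∩ T) := by
    intro A hA
    simp only [l]
    conv_rhs => rw [hh]
    rw [withDensity_apply _ (hA.inter hT), withDensity_apply _ (hA.inter hT)]
    exact setLIntegral_congr_fun (hA.inter hT) fun x hx => by simp only [hfT x hx.2]
  have heT : ∀ x ∈ Tᶜ, 2 * m - x ∈ T := by
    intro x hx
    have : ¬ σ * (x - m) ≤ 0 := hx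
    show σ * (2 * m - x - m) ≤ 0
    linarith
  have hA2 : ∀ A, MeasurableSet A → l (A \ T) = ν (e ⁻¹' (A \ T)) := by
    intro A hA
    simp only [l]
    conv_rhs => rw [hh]
    rw [withDensity_apply _ (hA.diff hT), withDensity_apply _ (e.measurable (hA.diff hT)),
      ← hrefl (fun x => ENNReal.ofReal (h x)) _ (hA.diff hT)]
    exact setLIntegral_congr_fun (hA.diff hT) fun x hx => by
      simp only [← hfT _ (heT x hx.2), hfs]
  have hA3 : ∀ A, MeasurableSet A → ν (e ⁻¹' (A \ T)) ≤ ν (A \ T) := by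
    intro A hA
    rw [hf1, withDensity_apply _ (hA.diff hT), withDensity_apply _ (e.measurable (hA.diff hT)),
      ← hrefl (fun x => ENNReal.ofReal (f1 x)) _ (hA.diff hT)]
    refine setLIntegral_mono' (hA.diff hT) fun x hx => ENNReal.ofReal_le_ofReal ?_
    have hx' : ¬ σ * (x - m) ≤ 0 := hx.2
    have := htail (σ * (x - m)) (by linarith)
    rw [← mul_assoc, hσ] at this
    convert this using 2 <;> ring
  refine ⟨l, f, ?_, ?_, rfl, hfm, ?_, ?_⟩
  · refine Measure.le_iff.2 fun A hA => ?_
    rw [← measure_inter_add_sdiff A hT, ← measure_inter_add_sdiff (μ := ν) A hT, hA1 A hA, hA2 A hA]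
    exact add_le_add le_rfl (hA3 A hA)
  · rw [← measure_inter_add_sdiff univ hT, hA1 _ .univ, hA2 _ .univ, univ_inter, two_mul]
    congr 1
    apply measure_congr
    have h0 : ν {m} = 0 := hac (by simp)
    have : ∀ᵐ x ∂ν, x ≠ m := by
      rw [ae_iff]; simpa using h0
    filter_upwards [this] with x hx
    apply propext
    show (2 * m - x ∈ univ \ T) ↔ x ∈ T
    simp only [T, mem_sdiff, mem_univ, true_and, mem_ofPred_eq, not_le]
    have : σ * (x - m) ≠ 0 := by
      rcases hσ' with r | r <;> subst r <;> simp [sub_eq_zero, hx, hx.symm]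
    rw [show 2 * m - x - m = -(x - m) by ring, mul_neg, Left.neg_pos_iff]
    exact ⟨le_of_lt, fun h => lt_of_le_of_ne h this⟩
  · intro x
    rw [← hfs]; congr 1; ring
  · refine Measure.ext fun A hA => ?_
    show Measure.map e l A = l A
    rw [Measure.map_apply e.measurable hA]
    simp only [l]
    rw [withDensity_apply _ (e.measurable hA), withDensity_apply _ hA,
      ← hrefl (fun x => ENNReal.ofReal (f x)) _ hA]
    simp only [hfs]

theorem sym_mean (l : Measure ℝ) [IsProbabilityMeasure l] (m : ℝ)
    (hs : Measure.map (fun x => 2 * m - x) l = l) (hi : Integrable (fun x => x) l) :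
    ∫ x, x ∂l = m := by
  have h1 : ∫ x, x ∂l = ∫ x, (2 * m - x) ∂l := by
    conv_lhs => rw [← hs]
    rw [integral_map (by fun_prop) (by fun_prop)]
  rw [integral_sub (integrable_const _) hi] at h1
  simp at h1
  linarith

end LeeAux

namespace LeeAux

/-- Real-valued indicator of a Boolean. -/
def bv (b : Bool) : ℝ := if b then 1 else 0

theorem bv_one (b : Bool) : bv b = 1 ↔ b = true := by cases b <;> simp [bv]
theorem bv_zero (b : Bool) : bv b = 0 ↔ b = false := by cases b <;> simp [bv]
theorem bv_or (b : Bool) : bv b = 0 ∨ bv b = 1 := by cases b <;> simp [bv]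

theorem bv_meas : Measurable bv := measurable_of_finite _

/-- The law of latent variables `((Y1, Y0), S1, S0)`, from the laws on each selection cell. -/
def mix (m11 m01 m10 m00 : Measure (ℝ × ℝ)) : Measure ((ℝ × ℝ) × Bool × Bool) :=
  m11.map (fun z => (z, true, true)) + m01.map (fun z => (z, false, true)) +
    m10.map (fun z => (z, true, false)) + m00.map (fun z => (z, false, false))

theorem mix_apply (m11 m01 m10 m00 : Measure (ℝ × ℝ)) (B : Set ((ℝ × ℝ) × Bool × Bool))
    (hB : MeasurableSet B) : mix m11 m01 m10 m00 B =
      m11 {z | (z, true, true) ∈ B} + m01 {z | (z, false, true) ∈ B} +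
      m10 {z | (z, true, false) ∈ B} + m00 {z | (z, false, false) ∈ B} := by
  have hm : ∀ b : Bool × Bool, Measurable (fun z : ℝ × ℝ => (z, b)) := fun b => by fun_prop
  simp only [mix, Measure.add_apply]
  rw [Measure.map_apply (hm _) hB, Measure.map_apply (hm _) hB, Measure.map_apply (hm _) hB,
    Measure.map_apply (hm _) hB]
  rfl

theorem mix_integrable (m11 m01 m10 m00 : Measure (ℝ × ℝ)) (g : ℝ × ℝ → ℝ) (hg : Measurable g)
    (h1 : Integrable g m11) (h2 : Integrable g m01) (h3 : Integrable g m10)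
    (h4 : Integrable g m00) :
    Integrable (fun w : (ℝ × ℝ) × Bool × Bool => g w.1) (mix m11 m01 m10 m00) := by
  have hm : ∀ b : Bool × Bool, Measurable (fun z : ℝ × ℝ => (z, b)) := fun b => by fun_prop
  have hg' : Measurable (fun w : (ℝ × ℝ) × Bool × Bool => g w.1) := hg.comp measurable_fst
  have key : ∀ (k : Measure (ℝ × ℝ)) (b : Bool × Bool), Integrable g k →
      Integrable (fun w : (ℝ × ℝ) × Bool × Bool => g w.1) (k.map (fun z => (z, b))) := by
    intro k b hk
    rw [integrable_map_measure hg'.aestronglyMeasurable (hm b).aemeasurable]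
    exact hk
  exact (((key _ _ h1).add_measure (key _ _ h2)).add_measure (key _ _ h3)).add_measure (key _ _ h4)

theorem build (ϑL ϑ α0 α1 p : ℝ) (hα0 : 0 < α0) (hα1 : 0 < α1) (hϑ0 : 0 < ϑ) (hϑ1 : ϑ ≤ 1)
    (hL : ϑL ≤ ϑ) (hp0 : 0 ≤ p) (hp1 : p ≤ 1) (h00 : 0 ≤ 1 - α0 - α1 + ϑ * α0)
    (h10 : 0 ≤ α1 - ϑ * α0)
    (ν l η r : Measure ℝ) [IsProbabilityMeasure ν] [IsProbabilityMeasure l]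
    [IsProbabilityMeasure η]
    (hr : ENNReal.ofReal (ϑ * α0) • l + r = ENNReal.ofReal α1 • ν)
    (hνi : Integrable (fun x => x) ν) (hli : Integrable (fun x => x) l)
    (hηi : Integrable (fun x => x) η)
    (f : ℝ → ℝ) (m : ℝ) (hf : l = volume.withDensity fun x => ENNReal.ofReal (f x))
    (hfs : ∀ x, f (m + x) = f (m - x)) :
    ∃ c : SelectionConfig ϑL,
      (∀ A : Set ℝ, MeasurableSet A →
        c.μ' {ω | c.Y' ω ∈ A ∧ c.S' ω = 1 ∧ c.D' ω = 1} =
            ENNReal.ofReal p * (ENNReal.ofReal α1 * ν A) ∧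
        c.μ' {ω | c.Y' ω ∈ A ∧ c.S' ω = 1 ∧ c.D' ω = 0} =
            ENNReal.ofReal (1 - p) * (ENNReal.ofReal α0 * η A) ∧
        c.μ' {ω | c.Y' ω ∈ A ∧ c.S' ω = 0 ∧ c.D' ω = 1} =
            ENNReal.ofReal p * (ENNReal.ofReal (1 - α1) * A.indicator 1 0) ∧
        c.μ' {ω | c.Y' ω ∈ A ∧ c.S' ω = 0 ∧ c.D' ω = 0} =
            ENNReal.ofReal (1 - p) * (ENNReal.ofReal (1 - α0) * A.indicator 1 0)) ∧
      cexp c.μ' (fun ω => c.Y1' ω - c.Y0' ω) {ω | c.S0' ω = 1 ∧ c.S1' ω = 1} =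
        (∫ x, x ∂l) - ∫ x, x ∂η := by
  let κ : Measure (ℝ × ℝ) := l.prod η
  have hru : r univ = ENNReal.ofReal (α1 - ϑ * α0) := by
    have h := congrArg (fun k : Measure ℝ => k univ) hr
    simp only [Measure.add_apply, Measure.smul_apply, measure_univ, smul_eq_mul, mul_one] at h
    rw [ENNReal.ofReal_sub _ (by positivity), ← h, ENNReal.add_sub_cancel_left ENNReal.ofReal_ne_top]
  have : IsFiniteMeasure r := ⟨by rw [hru]; exact ENNReal.ofReal_lt_top⟩
  have hri : Integrable (fun x => x) r := by
    have : Integrable (fun x => x) (ENNReal.ofReal α1 • ν) := hνi.smul_measure ENNReal.ofReal_ne_top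
    refine this.mono_measure ?_
    rw [← hr]; exact Measure.le_add_left le_rfl
  let m11 : Measure (ℝ × ℝ) := ENNReal.ofReal (ϑ * α0) • κ
  let m01 : Measure (ℝ × ℝ) := ENNReal.ofReal ((1 - ϑ) * α0) • κ
  let m10 : Measure (ℝ × ℝ) := r.prod (Measure.dirac 0)
  let m00 : Measure (ℝ × ℝ) := ENNReal.ofReal (1 - α0 - α1 + ϑ * α0) • Measure.dirac (0, 0)
  let M := mix m11 m01 m10 m00
  let ρ : Measure Bool := ENNReal.ofReal p • Measure.dirac true +
    ENNReal.ofReal (1 - p) • Measure.dirac false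
  have hρt : ρ {true} = ENNReal.ofReal p := by simp [ρ]
  have hρf : ρ {false} = ENNReal.ofReal (1 - p) := by simp [ρ]
  have : IsProbabilityMeasure ρ := ⟨by
    simp only [ρ, Measure.add_apply, Measure.smul_apply, measure_univ, smul_eq_mul, mul_one]
    rw [← ENNReal.ofReal_add hp0 (by linarith)]; simp⟩
  have hϑ1' : 0 ≤ (1 - ϑ) * α0 := mul_nonneg (by linarith) hα0.le
  have hϑ0' : 0 < ϑ * α0 := by positivity
  have : IsProbabilityMeasure M := ⟨by
    simp only [M]
    rw [mix_apply _ _ _ _ _ MeasurableSet.univ]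
    have : m10 univ = ENNReal.ofReal (α1 - ϑ * α0) := by
      simp only [m10]; rw [← univ_prod_univ, Measure.prod_prod, hru]; simp
    simp only [mem_univ, ofPred_true, this]
    simp only [m11, m01, m00, Measure.smul_apply, measure_univ, smul_eq_mul, mul_one, κ]
    rw [← ENNReal.ofReal_add hϑ0'.le hϑ1', ← ENNReal.ofReal_add (by positivity) h10,
      ← ENNReal.ofReal_add (by positivity) h00, ← ENNReal.ofReal_one]
    congr 1; ring⟩
  let P : Measure (((ℝ × ℝ) × Bool × Bool) × Bool) := M.prod ρ
  have : IsProbabilityMeasure P := by simp only [P]; infer_instance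
  have hPfst : ∀ B, MeasurableSet B → P {ω | ω.1 ∈ B} = M B := by
    intro B hB
    have : {ω : ((ℝ × ℝ) × Bool × Bool) × Bool | ω.1 ∈ B} = B ×ˢ univ := by ext; simp
    rw [this]; simp only [P, Measure.prod_prod, measure_univ, mul_one]
  have hPd : ∀ B (b : Bool), P {ω | ω.1 ∈ B ∧ ω.2 = b} = ρ {b} * M B := by
    intro B b
    have : {ω : ((ℝ × ℝ) × Bool × Bool) × Bool | ω.1 ∈ B ∧ ω.2 = b} = B ×ˢ {b} := by ext; simp
    rw [this]; simp [P, Measure.prod_prod, mul_comm]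
  have hcell : ∀ (A : Set (ℝ × ℝ)) (Q : Set (Bool × Bool)), MeasurableSet A →
      MeasurableSet {w : (ℝ × ℝ) × Bool × Bool | w.1 ∈ A ∧ w.2 ∈ Q} := fun A Q hA =>
    hA.prod (MeasurableSet.of_discrete (s := Q))
  -- restriction to always-takers
  have hres : Measure.map (fun ω : ((ℝ × ℝ) × Bool × Bool) × Bool => ω.1.1)
      (P.restrict {ω | bv ω.1.2.2 = 1 ∧ bv ω.1.2.1 = 1}) = m11 := by
    refine Measure.ext fun A hA => ?_
    rw [Measure.map_apply (by fun_prop) hA, Measure.restrict_apply (by measurability)]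
    have : (fun ω : ((ℝ × ℝ) × Bool × Bool) × Bool => ω.1.1) ⁻¹' A ∩
        {ω | bv ω.1.2.2 = 1 ∧ bv ω.1.2.1 = 1} =
        {ω | ω.1 ∈ {w : (ℝ × ℝ) × Bool × Bool | w.1 ∈ A ∧ w.2 ∈ ({(true, true)} : Set _)}} := by
      ext ω; simp [bv_one, Prod.ext_iff]; tauto
    rw [this, hPfst _ (hcell _ _ hA)]
    simp only [M]
    rw [mix_apply _ _ _ _ _ (hcell _ _ hA)]
    simp
  have hresE : P {ω | bv ω.1.2.2 = 1 ∧ bv ω.1.2.1 = 1} = ENNReal.ofReal (ϑ * α0) := by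
    have h := congrArg (fun k : Measure (ℝ × ℝ) => k univ) hres
    beta_reduce at h
    rw [Measure.map_apply (by fun_prop) .univ] at h
    simpa [m11, κ] using h
  have hS0 : ∀ (A : Set (ℝ × ℝ)) (B : Set ℝ), MeasurableSet A → MeasurableSet B →
      P ({ω | bv ω.1.2.2 = 1} ∩ {ω | ω.1.1 ∈ A ∧ bv ω.1.2.1 ∈ B}) =
      κ A * (ENNReal.ofReal (ϑ * α0) * B.indicator 1 1 +
        ENNReal.ofReal ((1 - ϑ) * α0) * B.indicator 1 0) := by
    intro A B hA hB
    have : {ω : ((ℝ × ℝ) × Bool × Bool) × Bool | bv ω.1.2.2 = 1} ∩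
        {ω | ω.1.1 ∈ A ∧ bv ω.1.2.1 ∈ B} =
        {ω | ω.1 ∈ {w : (ℝ × ℝ) × Bool × Bool | w.1 ∈ A ∧
          w.2 ∈ {b : Bool × Bool | b.2 = true ∧ bv b.1 ∈ B}}} := by
      ext ω; simp [bv_one]; tauto
    rw [this, hPfst _ (hcell _ _ hA)]
    simp only [M]
    rw [mix_apply _ _ _ _ _ (hcell _ _ hA)]
    by_cases h1 : (1 : ℝ) ∈ B <;> by_cases h0 : (0 : ℝ) ∈ B <;>
      simp [bv, h1, h0, m11, m01, mul_comm, add_mul]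
  have hS0E : P {ω | bv ω.1.2.2 = 1} = ENNReal.ofReal α0 := by
    have := hS0 univ univ .univ .univ
    simp only [mem_univ, and_self, ofPred_true, inter_univ] at this
    rw [this]
    simp only [κ, measure_univ, indicator_univ, Pi.one_apply, mul_one, one_mul]
    rw [← ENNReal.ofReal_add hϑ0'.le hϑ1']
    congr 1; ring
  have mS0 : MeasurableSet {ω : ((ℝ × ℝ) × Bool × Bool) × Bool | bv ω.1.2.2 = 1} :=
    (bv_meas.comp (by fun_prop : Measurable
      fun ω : ((ℝ × ℝ) × Bool × Bool) × Bool => ω.1.2.2)) (measurableSet_singleton 1)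
  have mAT : MeasurableSet {ω : ((ℝ × ℝ) × Bool × Bool) × Bool |
      bv ω.1.2.2 = 1 ∧ bv ω.1.2.1 = 1} := mS0.inter ((bv_meas.comp (by fun_prop : Measurable
      fun ω : ((ℝ × ℝ) × Bool × Bool) × Bool => ω.1.2.1)) (measurableSet_singleton 1))
  have iY1 : Integrable (fun ω : ((ℝ × ℝ) × Bool × Bool) × Bool => ω.1.1.1) P := by
    have hk : Integrable (fun z : ℝ × ℝ => z.1) κ := hli.comp_fst η
    have h := mix_integrable m11 m01 m10 m00 (fun z => z.1) measurable_fst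
      (hk.smul_measure ENNReal.ofReal_ne_top) (hk.smul_measure ENNReal.ofReal_ne_top)
      (hri.comp_fst _) ((integrable_dirac (by simp)).smul_measure ENNReal.ofReal_ne_top)
    exact h.comp_fst ρ
  have iY0 : Integrable (fun ω : ((ℝ × ℝ) × Bool × Bool) × Bool => ω.1.1.2) P := by
    have hk : Integrable (fun z : ℝ × ℝ => z.2) κ := hηi.comp_snd l
    have h := mix_integrable m11 m01 m10 m00 (fun z => z.2) measurable_snd
      (hk.smul_measure ENNReal.ofReal_ne_top) (hk.smul_measure ENNReal.ofReal_ne_top)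
      ((integrable_dirac (f := fun x : ℝ => x) (by simp)).comp_snd r)
      ((integrable_dirac (by simp)).smul_measure ENNReal.ofReal_ne_top)
    exact h.comp_fst ρ
  let c : SelectionConfig ϑL :=
    { carrier := ((ℝ × ℝ) × Bool × Bool) × Bool
      μ' := P
      prob := inferInstance
      Y1' := fun ω => ω.1.1.1
      Y0' := fun ω => ω.1.1.2
      S1' := fun ω => bv ω.1.2.1
      S0' := fun ω => bv ω.1.2.2
      D' := fun ω => bv ω.2
      S' := fun ω => bv ω.1.2.1 * bv ω.2 + bv ω.1.2.2 * (1 - bv ω.2)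
      Y' := fun ω => (bv ω.1.2.1 * bv ω.2 + bv ω.1.2.2 * (1 - bv ω.2)) *
        (ω.1.1.1 * bv ω.2 + ω.1.1.2 * (1 - bv ω.2))
      meas_Y1 := by fun_prop
      meas_Y0 := by fun_prop
      meas_S1 := bv_meas.comp (by fun_prop)
      meas_S0 := bv_meas.comp (by fun_prop)
      meas_D := bv_meas.comp (by fun_prop)
      vals_S1 := fun ω => bv_or _
      vals_S0 := fun ω => bv_or _
      vals_D := fun ω => bv_or _
      hS' := fun ω => rfl
      hY' := fun ω => rfl
      int_Y1 := iY1
      int_Y0 := iY0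
      indep := by
        have h1 : Measurable (fun w : (ℝ × ℝ) × Bool × Bool =>
            (w.1.1, w.1.2, bv w.2.1, bv w.2.2)) := by
          have := bv_meas
          fun_prop
        exact indepFun_prod h1 bv_meas
      sm1 := by
        have e : {ω : ((ℝ × ℝ) × Bool × Bool) × Bool | bv ω.1.2.2 = 1} ∩ {ω | bv ω.1.2.1 = 1} =
          {ω | bv ω.1.2.2 = 1 ∧ bv ω.1.2.1 = 1} := rfl
        simp only [cpr, pr]
        rw [e, hresE, hS0E, ENNReal.toReal_ofReal hϑ0'.le, ENNReal.toReal_ofReal hα0.le,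
          mul_div_assoc, div_self hα0.ne', mul_one]
        exact hL
      sm2 := by
        rw [indepFun_iff_measure_inter_preimage_eq_mul]
        intro A B hA hB
        rw [cond_apply mS0, cond_apply mS0, cond_apply mS0, hS0E]
        have e1 := hS0 A B hA hB
        have e2 := hS0 A univ hA .univ
        have e3 := hS0 univ B .univ hB
        have e4 := hS0 univ univ .univ .univ
        simp only [mem_univ, and_self, ofPred_true, inter_univ, hS0E, and_true, true_and] at e2 e3 e4
        have hku : κ univ = 1 := by simp [κ]
        rw [hku, one_mul] at e3 e4
        have e1' : P ({ω | bv ω.1.2.2 = 1} ∩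
            ((fun ω : ((ℝ × ℝ) × Bool × Bool) × Bool => (ω.1.1.1, ω.1.1.2)) ⁻¹' A ∩
            (fun ω : ((ℝ × ℝ) × Bool × Bool) × Bool => bv ω.1.2.1) ⁻¹' B)) = _ := e1
        have e2' : P ({ω | bv ω.1.2.2 = 1} ∩
            ((fun ω : ((ℝ × ℝ) × Bool × Bool) × Bool => (ω.1.1.1, ω.1.1.2)) ⁻¹' A)) = _ := e2
        have e3' : P ({ω | bv ω.1.2.2 = 1} ∩
            ((fun ω : ((ℝ × ℝ) × Bool × Bool) × Bool => bv ω.1.2.1) ⁻¹' B)) = _ := e3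
        rw [e1', e2', e3', ← e4]
        have h0 : ENNReal.ofReal α0 ≠ 0 := by simpa using hα0
        generalize (ENNReal.ofReal (ϑ * α0) * B.indicator 1 1 +
          ENNReal.ofReal ((1 - ϑ) * α0) * B.indicator 1 0) = β
        rw [mul_comm (κ A) (ENNReal.ofReal α0), ← mul_assoc _ (ENNReal.ofReal α0),
          ENNReal.inv_mul_cancel h0 ENNReal.ofReal_ne_top, one_mul]
        ring
      symm := by
        refine ⟨f, m, ?_, hfs⟩
        rw [← hf]
        have h0 : ENNReal.ofReal (ϑ * α0) ≠ 0 := by simpa using hϑ0'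
        have e : (fun ω : ((ℝ × ℝ) × Bool × Bool) × Bool => ω.1.1.1) =
          Prod.fst ∘ (fun ω : ((ℝ × ℝ) × Bool × Bool) × Bool => ω.1.1) := rfl
        rw [ProbabilityTheory.cond, hresE, Measure.map_smul, e, ← Measure.map_map measurable_fst (by fun_prop), hres]
        simp only [m11, Measure.map_smul, smul_smul,
          ENNReal.inv_mul_cancel h0 ENNReal.ofReal_ne_top, one_smul, κ]
        rw [Measure.map_fst_prod]; simp }
  refine ⟨c, ?_, ?_⟩
  · intro A hA
    show P {ω | (bv ω.1.2.1 * bv ω.2 + bv ω.1.2.2 * (1 - bv ω.2)) *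
        (ω.1.1.1 * bv ω.2 + ω.1.1.2 * (1 - bv ω.2)) ∈ A ∧
        bv ω.1.2.1 * bv ω.2 + bv ω.1.2.2 * (1 - bv ω.2) = 1 ∧ bv ω.2 = 1} = _ ∧
      P {ω | (bv ω.1.2.1 * bv ω.2 + bv ω.1.2.2 * (1 - bv ω.2)) *
        (ω.1.1.1 * bv ω.2 + ω.1.1.2 * (1 - bv ω.2)) ∈ A ∧
        bv ω.1.2.1 * bv ω.2 + bv ω.1.2.2 * (1 - bv ω.2) = 1 ∧ bv ω.2 = 0} = _ ∧
      P {ω | (bv ω.1.2.1 * bv ω.2 + bv ω.1.2.2 * (1 - bv ω.2)) *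
        (ω.1.1.1 * bv ω.2 + ω.1.1.2 * (1 - bv ω.2)) ∈ A ∧
        bv ω.1.2.1 * bv ω.2 + bv ω.1.2.2 * (1 - bv ω.2) = 0 ∧ bv ω.2 = 1} = _ ∧
      P {ω | (bv ω.1.2.1 * bv ω.2 + bv ω.1.2.2 * (1 - bv ω.2)) *
        (ω.1.1.1 * bv ω.2 + ω.1.1.2 * (1 - bv ω.2)) ∈ A ∧
        bv ω.1.2.1 * bv ω.2 + bv ω.1.2.2 * (1 - bv ω.2) = 0 ∧ bv ω.2 = 0} = _
    have hku : κ univ = 1 := by simp [κ]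
    have hm10u : m10 univ = ENNReal.ofReal (α1 - ϑ * α0) := by
      simp only [m10]; rw [← univ_prod_univ, Measure.prod_prod, hru]; simp
    have hk1 : κ {z | z.1 ∈ A} = l A := by
      have : {z : ℝ × ℝ | z.1 ∈ A} = A ×ˢ univ := by ext; simp
      rw [this]; simp [κ, Measure.prod_prod]
    have hk2 : κ {z | z.2 ∈ A} = η A := by
      have : {z : ℝ × ℝ | z.2 ∈ A} = univ ×ˢ A := by ext; simp
      rw [this]; simp [κ, Measure.prod_prod]
    have hk3 : m10 {z | z.1 ∈ A} = r A := by
      have : {z : ℝ × ℝ | z.1 ∈ A} = A ×ˢ univ := by ext; simp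
      rw [this]; simp [m10, Measure.prod_prod]
    have mf : MeasurableSet {z : ℝ × ℝ | z.1 ∈ A} := measurable_fst hA
    have ms : MeasurableSet {z : ℝ × ℝ | z.2 ∈ A} := measurable_snd hA
    refine ⟨?_, ?_, ?_, ?_⟩
    · rw [← hρt, show ENNReal.ofReal α1 * ν A = M {w : (ℝ × ℝ) × Bool × Bool |
          w.1 ∈ {z : ℝ × ℝ | z.1 ∈ A} ∧ w.2 ∈ {b : Bool × Bool | b.1 = true}} from ?_, ← hPd]
      · congr 1; ext ⟨⟨z, s1, s0⟩, d⟩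
        cases s1 <;> cases s0 <;> cases d <;> simp [bv]
      · have h := congrArg (fun k : Measure ℝ => k A) hr
        simp only [Measure.add_apply, Measure.smul_apply, smul_eq_mul] at h
        simp only [M]
        rw [← h, mix_apply _ _ _ _ _ (hcell _ _ mf)]
        simp [hk3, m11, hk1]
    · rw [← hρf, show ENNReal.ofReal α0 * η A = M {w : (ℝ × ℝ) × Bool × Bool |
          w.1 ∈ {z : ℝ × ℝ | z.2 ∈ A} ∧ w.2 ∈ {b : Bool × Bool | b.2 = true}} from ?_, ← hPd]
      · congr 1; ext ⟨⟨z, s1, s0⟩, d⟩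
        cases s1 <;> cases s0 <;> cases d <;> simp [bv]
      · simp only [M]
        rw [mix_apply _ _ _ _ _ (hcell _ _ ms)]
        simp only [mem_ofPred_eq, and_true, and_false, ofPred_false, measure_empty, add_zero,
          m11, m01, Measure.smul_apply, smul_eq_mul, hk2, Bool.false_eq_true]
        rw [← add_mul, ← ENNReal.ofReal_add hϑ0'.le hϑ1']
        congr 2; ring
    · by_cases h0 : (0 : ℝ) ∈ A
      · rw [← hρt, show ENNReal.ofReal (1 - α1) * A.indicator 1 0 = M {w : (ℝ × ℝ) × Bool × Bool |
          w.1 ∈ (univ : Set (ℝ × ℝ)) ∧ w.2 ∈ {b : Bool × Bool | b.1 = false}} from ?_, ← hPd]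
        · congr 1; ext ⟨⟨z, s1, s0⟩, d⟩
          cases s1 <;> cases s0 <;> cases d <;> simp [bv, h0]
        · simp only [M]
          rw [mix_apply _ _ _ _ _ (hcell _ _ .univ)]
          simp [m01, m00, hku, h0]
          rw [← ENNReal.ofReal_add hϑ1' h00]
          congr 1; ring
      · simp only [h0, not_false_eq_true, indicator_of_notMem, mul_zero]
        rw [← measure_empty (μ := P)]
        congr 1; ext ⟨⟨z, s1, s0⟩, d⟩
        cases s1 <;> cases s0 <;> cases d <;> simp [bv, h0]
    · by_cases h0 : (0 : ℝ) ∈ A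
      · rw [← hρf, show ENNReal.ofReal (1 - α0) * A.indicator 1 0 = M {w : (ℝ × ℝ) × Bool × Bool |
          w.1 ∈ (univ : Set (ℝ × ℝ)) ∧ w.2 ∈ {b : Bool × Bool | b.2 = false}} from ?_, ← hPd]
        · congr 1; ext ⟨⟨z, s1, s0⟩, d⟩
          cases s1 <;> cases s0 <;> cases d <;> simp [bv, h0]
        · simp only [M]
          rw [mix_apply _ _ _ _ _ (hcell _ _ .univ)]
          simp [hm10u, m00, h0]
          rw [← ENNReal.ofReal_add h10 h00]
          congr 1; ring
      · simp only [h0, not_false_eq_true, indicator_of_notMem, mul_zero]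
        rw [← measure_empty (μ := P)]
        congr 1; ext ⟨⟨z, s1, s0⟩, d⟩
        cases s1 <;> cases s0 <;> cases d <;> simp [bv, h0]
  · show (∫ ω in {ω | bv ω.1.2.2 = 1 ∧ bv ω.1.2.1 = 1}, (ω.1.1.1 - ω.1.1.2) ∂P) /
      (P {ω | bv ω.1.2.2 = 1 ∧ bv ω.1.2.1 = 1}).toReal = _
    have h : ∫ ω in {ω | bv ω.1.2.2 = 1 ∧ bv ω.1.2.1 = 1}, (ω.1.1.1 - ω.1.1.2) ∂P =
        ∫ z, (z.1 - z.2) ∂m11 := by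
      rw [← hres, integral_map (by fun_prop) (by fun_prop)]
    rw [h, hresE, ENNReal.toReal_ofReal hϑ0'.le]
    simp only [m11]
    rw [integral_smul_measure, ENNReal.toReal_ofReal hϑ0'.le, smul_eq_mul, mul_div_assoc,
      mul_comm, div_mul_cancel₀ _ hϑ0'.ne']
    simp only [κ]
    rw [integral_sub (hli.comp_fst η) (hηi.comp_snd l), integral_fun_fst (fun x => x),
      integral_fun_snd (fun x => x)]
    simp

end LeeAux

namespace LeeAux

theorem core (ϑL ϑ α0 α1 p : ℝ) (hα0 : 0 < α0) (hα1 : 0 < α1) (hϑ0 : 0 < ϑ) (hϑ1 : ϑ ≤ 1)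
    (hL : ϑL ≤ ϑ) (hp0 : 0 ≤ p) (hp1 : p ≤ 1) (h00 : 0 ≤ 1 - α0 - α1 + ϑ * α0)
    (h10 : 0 ≤ α1 - ϑ * α0)
    (ν η : Measure ℝ) [IsProbabilityMeasure ν] [IsProbabilityMeasure η]
    (hνi : Integrable (fun x => x) ν) (hηi : Integrable (fun x => x) η)
    (f1 : ℝ → ℝ)
    (hf1 : ν = volume.withDensity fun x => ENNReal.ofReal (f1 x)) (m σ : ℝ) (hσ : σ * σ = 1)
    (htail : ∀ a : ℝ, 0 ≤ a → f1 (m - σ * a) ≤ f1 (m + σ * a))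
    (hmass : ν {x | σ * (x - m) ≤ 0} = ENNReal.ofReal (ϑ * (α0 / α1) / 2)) :
    ∃ c : SelectionConfig ϑL,
      (∀ A : Set ℝ, MeasurableSet A →
        c.μ' {ω | c.Y' ω ∈ A ∧ c.S' ω = 1 ∧ c.D' ω = 1} =
            ENNReal.ofReal p * (ENNReal.ofReal α1 * ν A) ∧
        c.μ' {ω | c.Y' ω ∈ A ∧ c.S' ω = 1 ∧ c.D' ω = 0} =
            ENNReal.ofReal (1 - p) * (ENNReal.ofReal α0 * η A) ∧
        c.μ' {ω | c.Y' ω ∈ A ∧ c.S' ω = 0 ∧ c.D' ω = 1} =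
            ENNReal.ofReal p * (ENNReal.ofReal (1 - α1) * A.indicator 1 0) ∧
        c.μ' {ω | c.Y' ω ∈ A ∧ c.S' ω = 0 ∧ c.D' ω = 0} =
            ENNReal.ofReal (1 - p) * (ENNReal.ofReal (1 - α0) * A.indicator 1 0)) ∧
      cexp c.μ' (fun ω => c.Y1' ω - c.Y0' ω) {ω | c.S0' ω = 1 ∧ c.S1' ω = 1} =
        m - ∫ x, x ∂η := by
  obtain ⟨l0, f, hle, hu, hd, hfm, hfs, hsym⟩ := sym_lemma ν f1 hf1 m σ hσ htail
  let k : ℝ := ϑ * (α0 / α1)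
  have hk : 0 < k := by positivity
  have hu' : l0 univ = ENNReal.ofReal k := by
    rw [hu, hmass, ← ENNReal.ofReal_ofNat, ← ENNReal.ofReal_mul (by norm_num)]
    congr 1
    simp only [k]; ring
  have : IsFiniteMeasure l0 := ⟨by rw [hu']; exact ENNReal.ofReal_lt_top⟩
  let l : Measure ℝ := ENNReal.ofReal k⁻¹ • l0
  have : IsProbabilityMeasure l := ⟨by
    simp only [l, Measure.smul_apply, hu', smul_eq_mul]
    rw [← ENNReal.ofReal_mul (by positivity), inv_mul_cancel₀ hk.ne', ENNReal.ofReal_one]⟩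
  have hli : Integrable (fun x => x) l :=
    (hνi.mono_measure hle).smul_measure ENNReal.ofReal_ne_top
  have hr : ENNReal.ofReal (ϑ * α0) • l + ENNReal.ofReal α1 • (ν - l0) = ENNReal.ofReal α1 • ν := by
    have h1 : ENNReal.ofReal (ϑ * α0) • l = ENNReal.ofReal α1 • l0 := by
      simp only [l, smul_smul]
      rw [← ENNReal.ofReal_mul (by positivity)]
      congr 2
      simp only [k]; field_simp
    rw [h1, ← smul_add, add_comm, Measure.sub_add_cancel_of_le hle]
  have hld : l = volume.withDensity fun x => ENNReal.ofReal (k⁻¹ * f x) := by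
    have : (fun x => ENNReal.ofReal (k⁻¹ * f x)) =
        ENNReal.ofReal k⁻¹ • fun x => ENNReal.ofReal (f x) := by
      ext x; simp [ENNReal.ofReal_mul (inv_nonneg.2 hk.le)]
    rw [this, withDensity_smul _ hfm.ennreal_ofReal, ← hd]
  have hls : Measure.map (fun x => 2 * m - x) l = l := by
    simp only [l, Measure.map_smul, hsym]
  have := build ϑL ϑ α0 α1 p hα0 hα1 hϑ0 hϑ1 hL hp0 hp1 h00 h10 ν l η _ hr hνi hli hηi _ m hld
    (fun x => by simp only [hfs])
  rwa [sym_mean l m hls hli] at this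

theorem quantile (ν : Measure ℝ) [IsProbabilityMeasure ν] (F : ℝ → ℝ)
    (hF : ∀ t, F t = (ν (Iic t)).toReal) (hc : Continuous F) (hm : StrictMono F)
    (r : ℝ) (h0 : 0 < r) (h1 : r < 1) : F (sInf {t : ℝ | r ≤ F t}) = r := by
  have hF' : F = cdf ν := by ext t; rw [hF, cdf_eq_real]; rfl
  have hb : Filter.Tendsto F Filter.atBot (nhds 0) := by rw [hF']; exact tendsto_cdf_atBot ν
  have ht : Filter.Tendsto F Filter.atTop (nhds 1) := by rw [hF']; exact tendsto_cdf_atTop ν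
  obtain ⟨a, ha⟩ := (hb.eventually (gt_mem_nhds h0)).exists
  obtain ⟨b, hb⟩ := (ht.eventually (lt_mem_nhds h1)).exists
  obtain ⟨t, ht⟩ := mem_range_of_exists_le_of_exists_ge hc ⟨a, ha.le⟩ ⟨b, hb.le⟩
  have : {t' : ℝ | r ≤ F t'} = Ici t := by
    ext x; simp only [mem_ofPred_eq, mem_Ici]; rw [← ht, hm.le_iff_le]
  rw [this, csInf_Ici, ht]

end LeeAux

/-- **Theorem 2 (attainability part).** Under Assumptions 1, 3 and the tail smoothness
condition (Assumption 4), the symmetry bounds `∇̲ˢ` and `∇̄ˢ` are attained by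
configurations satisfying the model, Assumptions 1, 3 and the symmetry assumption
(Assumption 5), and inducing the same joint distribution of the observables. -/
theorem lee_bounds_symmetry_attainable
    (μ : Measure Ω) [IsProbabilityMeasure μ]
    (Y1 Y0 S1 S0 D S Y : Ω → ℝ)
    (hY1m : Measurable Y1) (hY0m : Measurable Y0)
    (hS1m : Measurable S1) (hS0m : Measurable S0) (hDm : Measurable D)
    (hS1v : ∀ ω, S1 ω = 0 ∨ S1 ω = 1) (hS0v : ∀ ω, S0 ω = 0 ∨ S0 ω = 1)
    (hDv : ∀ ω, D ω = 0 ∨ D ω = 1)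
    (hS : ∀ ω, S ω = S1 ω * D ω + S0 ω * (1 - D ω))
    (hY : ∀ ω, Y ω = S ω * (Y1 ω * D ω + Y0 ω * (1 - D ω)))
    (hY1i : Integrable Y1 μ) (hY0i : Integrable Y0 μ)
    -- Assumption 1 (independent assignment)
    (hIndep : IndepFun (fun ω => (Y1 ω, Y0 ω, S1 ω, S0 ω)) D μ)
    -- Assumption 3 (stochastic monotonicity)
    (ϑL : ℝ) (hϑL : ϑL ∈ Set.Ioc (0 : ℝ) 1)
    (hSM1 : ϑL ≤ cpr μ {ω | S0 ω = 1} {ω | S1 ω = 1})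
    (hSM2 : IndepFun (fun ω => (Y1 ω, Y0 ω)) S1 (μ[|{ω | S0 ω = 1}]))
    -- identified quantities
    (α0 q0 ϑF ϑ : ℝ) (F1 : ℝ → ℝ) (yq : ℝ → ℝ)
    (hα0 : α0 = cpr μ {ω | D ω = 0} {ω | S ω = 1})
    (hq0 : q0 = cpr μ {ω | D ω = 0} {ω | S ω = 1} / cpr μ {ω | D ω = 1} {ω | S ω = 1})
    (hϑF : ϑF = 1 + 1 / q0 - 1 / α0)
    (hϑ : ϑ = max ϑL ϑF)
    (hF1 : ∀ t, F1 t = cpr μ {ω | D ω = 1 ∧ S ω = 1} {ω | Y ω ≤ t})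
    (hyq : ∀ r, yq r = sInf {t : ℝ | r ≤ F1 t})
    (hF1cont : Continuous F1) (hF1mono : StrictMono F1)
    -- positivity conditions
    (hD1 : 0 < pr μ {ω | D ω = 1}) (hD1' : pr μ {ω | D ω = 1} < 1)
    (hSD0 : 0 < pr μ {ω | S ω = 1 ∧ D ω = 0})
    (hSD1 : 0 < pr μ {ω | S ω = 1 ∧ D ω = 1})
    (hAT : 0 < pr μ {ω | S0 ω = 1 ∧ S1 ω = 1})
    -- conditional density of Y given {D=1, S=1}
    (f1 : ℝ → ℝ)
    (hf1 : Measure.map Y (μ[|{ω | D ω = 1 ∧ S ω = 1}])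
        = volume.withDensity fun x => ENNReal.ofReal (f1 x))
    -- Assumption 4 (tail smoothness)
    (htailL : ∀ a : ℝ, 0 ≤ a → f1 (yq (ϑ * q0 / 2) - a) ≤ f1 (yq (ϑ * q0 / 2) + a))
    (htailU : ∀ a : ℝ, 0 ≤ a → f1 (yq (1 - ϑ * q0 / 2) + a) ≤ f1 (yq (1 - ϑ * q0 / 2) - a)) :
    (∃ c : SelectionConfig ϑL,
      Measure.map (fun ω => (c.Y' ω, c.S' ω, c.D' ω)) c.μ'
          = Measure.map (fun ω => (Y ω, S ω, D ω)) μ ∧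
        cexp c.μ' (fun ω => c.Y1' ω - c.Y0' ω) {ω | c.S0' ω = 1 ∧ c.S1' ω = 1}
          = yq (1 - ϑ * q0 / 2) - cexp μ Y {ω | D ω = 0 ∧ S ω = 1}) ∧
    (∃ c : SelectionConfig ϑL,
      Measure.map (fun ω => (c.Y' ω, c.S' ω, c.D' ω)) c.μ'
          = Measure.map (fun ω => (Y ω, S ω, D ω)) μ ∧
        cexp c.μ' (fun ω => c.Y1' ω - c.Y0' ω) {ω | c.S0' ω = 1 ∧ c.S1' ω = 1}
          = yq (ϑ * q0 / 2) - cexp μ Y {ω | D ω = 0 ∧ S ω = 1}) := by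
  classical
  have hSv : ∀ ω, S ω = 0 ∨ S ω = 1 := by
    intro ω
    rcases hS1v ω with a | a <;> rcases hS0v ω with b | b <;> rcases hDv ω with d | d <;>
      simp [hS, a, b, d]
  have hSm : Measurable S := by
    rw [show S = fun ω => S1 ω * D ω + S0 ω * (1 - D ω) from funext hS]; fun_prop
  have hYm : Measurable Y := by
    rw [show Y = fun ω => S ω * (Y1 ω * D ω + Y0 ω * (1 - D ω)) from funext hY]; fun_prop
  have hYi : Integrable Y μ := by
    refine (hY1i.abs.add hY0i.abs).mono' hYm.aestronglyMeasurable (ae_of_all _ fun ω => ?_)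
    simp only [Pi.add_apply, Real.norm_eq_abs]
    have e1 := abs_nonneg (Y1 ω)
    have e2 := abs_nonneg (Y0 ω)
    rcases hSv ω with a | a <;> rcases hDv ω with d | d <;> simp [hY, a, d] <;> linarith
  have mD : ∀ d : ℝ, MeasurableSet {ω | D ω = d} := fun d => hDm (measurableSet_singleton d)
  have mS : ∀ d : ℝ, MeasurableSet {ω | S ω = d} := fun d => hSm (measurableSet_singleton d)
  have mE : ∀ d : ℝ, MeasurableSet {ω | D ω = d ∧ S ω = 1} := fun d => (mD d).inter (mS 1)
  have hpr : ∀ A, pr μ A = μ.real A := fun A => rfl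
  -- independence
  have i1 : ∀ d : ℝ, pr μ {ω | D ω = d ∧ S1 ω = 1} = pr μ {ω | D ω = d} * pr μ {ω | S1 ω = 1} := by
    intro d
    have h : IndepFun S1 D μ := hIndep.comp (φ := fun x : ℝ × ℝ × ℝ × ℝ => x.2.2.1)
      (by fun_prop) measurable_id
    have := h.measure_inter_preimage_eq_mul {1} {d} (measurableSet_singleton _)
      (measurableSet_singleton _)
    simp only [pr]
    rw [← ENNReal.toReal_mul, mul_comm]
    congr 1
    rw [show {ω | D ω = d ∧ S1 ω = 1} = S1 ⁻¹' {1} ∩ D ⁻¹' {d} by ext; simp [and_comm]]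
    exact this
  have i0 : ∀ d : ℝ, pr μ {ω | D ω = d ∧ S0 ω = 1} = pr μ {ω | D ω = d} * pr μ {ω | S0 ω = 1} := by
    intro d
    have h : IndepFun S0 D μ := hIndep.comp (φ := fun x : ℝ × ℝ × ℝ × ℝ => x.2.2.2)
      (by fun_prop) measurable_id
    have := h.measure_inter_preimage_eq_mul {1} {d} (measurableSet_singleton _)
      (measurableSet_singleton _)
    simp only [pr]
    rw [← ENNReal.toReal_mul, mul_comm]
    congr 1
    rw [show {ω | D ω = d ∧ S0 ω = 1} = S0 ⁻¹' {1} ∩ D ⁻¹' {d} by ext; simp [and_comm]]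
    exact this
  set p := pr μ {ω | D ω = 1} with hp
  set α1 := pr μ {ω | S1 ω = 1} with hα1
  have hD0 : pr μ {ω | D ω = 0} = 1 - p := by
    have e : {ω | D ω = 0} = {ω | D ω = 1}ᶜ := by
      ext ω; rcases hDv ω with d | d <;> simp [d]
    rw [hp, hpr, hpr, e, probReal_compl_eq_one_sub (mD 1)]
  have hE1 : pr μ {ω | D ω = 1 ∧ S ω = 1} = p * α1 := by
    rw [hp, ← i1]; congr 1; ext ω; simp only [mem_ofPred_eq, hS]
    constructor <;> rintro ⟨a, b⟩ <;> simp_all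
  have hE0' : pr μ {ω | D ω = 0 ∧ S ω = 1} = (1 - p) * pr μ {ω | S0 ω = 1} := by
    rw [← hD0, ← i0]; congr 1; ext ω; simp only [mem_ofPred_eq, hS]
    constructor <;> rintro ⟨a, b⟩ <;> simp_all
  have hα0' : α0 = pr μ {ω | S0 ω = 1} := by
    rw [hα0]; unfold cpr
    rw [show {ω | D ω = 0} ∩ {ω | S ω = 1} = {ω | D ω = 0 ∧ S ω = 1} from rfl, hE0', hD0,
      mul_div_cancel_left₀ _ (by linarith)]
  have hE0 : pr μ {ω | D ω = 0 ∧ S ω = 1} = (1 - p) * α0 := by rw [hE0', hα0']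
  have hα1' : cpr μ {ω | D ω = 1} {ω | S ω = 1} = α1 := by
    unfold cpr
    rw [show {ω | D ω = 1} ∩ {ω | S ω = 1} = {ω | D ω = 1 ∧ S ω = 1} from rfl, hE1, ← hp,
      mul_div_cancel_left₀ _ hD1.ne']
  rw [← hα0, hα1'] at hq0
  have hc : ∀ d : ℝ, {ω | S ω = 1 ∧ D ω = d} = {ω | D ω = d ∧ S ω = 1} := by
    intro d; ext; simp [and_comm]
  rw [hc] at hSD0 hSD1
  have α1pos : 0 < α1 := by
    rw [hE1] at hSD1; exact pos_of_mul_pos_right hSD1 hD1.le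
  have α0pos : 0 < α0 := by
    rw [hE0] at hSD0; exact pos_of_mul_pos_right hSD0 (by linarith)
  have α1le : α1 ≤ 1 := by rw [hα1, hpr]; exact measureReal_le_one
  have hLα : ϑL * α0 ≤ α1 := by
    unfold cpr at hSM1
    rw [← hα0', le_div_iff₀ α0pos] at hSM1
    refine hSM1.trans ?_
    rw [hα1, hpr, hpr]
    exact measureReal_mono inter_subset_right
  have α0le : α0 ≤ 1 := by rw [hα0', hpr]; exact measureReal_le_one
  have hFα : ϑF * α0 = α0 + α1 - 1 := by
    rw [hϑF, hq0]; field_simp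
  have hϑ0 : 0 < ϑ := by rw [hϑ]; exact lt_max_of_lt_left hϑL.1
  have hLϑ : ϑL ≤ ϑ := by rw [hϑ]; exact le_max_left _ _
  have hFϑ : ϑF ≤ ϑ := by rw [hϑ]; exact le_max_right _ _
  have hϑ1 : ϑ ≤ 1 := by
    rw [hϑ]; refine max_le hϑL.2 ?_
    by_contra! hcon
    nlinarith
  have hϑα : ϑ * α0 ≤ α1 := by
    rcases max_choice ϑL ϑF with h | h <;> rw [h] at hϑ <;> rw [hϑ]
    · exact hLα
    · rw [hFα]; linarith
  have h00 : 0 ≤ 1 - α0 - α1 + ϑ * α0 := by nlinarith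
  have hk0 : 0 < ϑ * q0 := by rw [hq0]; positivity
  have hk1 : ϑ * q0 ≤ 1 := by
    rw [hq0, ← mul_div_assoc, div_le_one α1pos]; exact hϑα
  -- measures
  have n1 : μ {ω | D ω = 1 ∧ S ω = 1} ≠ 0 := fun h => by simp [pr, h] at hSD1
  have n0 : μ {ω | D ω = 0 ∧ S ω = 1} ≠ 0 := fun h => by simp [pr, h] at hSD0
  have hpc1 : IsProbabilityMeasure (μ[|{ω | D ω = 1 ∧ S ω = 1}]) := cond_isProbabilityMeasure n1
  have hpc0 : IsProbabilityMeasure (μ[|{ω | D ω = 0 ∧ S ω = 1}]) := cond_isProbabilityMeasure n0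
  have hic : ∀ d : ℝ, μ {ω | D ω = d ∧ S ω = 1} ≠ 0 →
      Integrable Y (μ[|{ω | D ω = d ∧ S ω = 1}]) := fun d hd =>
    hYi.integrableOn.smul_measure (ENNReal.inv_ne_top.2 hd)
  set ν := Measure.map Y (μ[|{ω | D ω = 1 ∧ S ω = 1}]) with hν
  set η := Measure.map Y (μ[|{ω | D ω = 0 ∧ S ω = 1}]) with hη
  have : IsProbabilityMeasure ν := Measure.isProbabilityMeasure_map hYm.aemeasurable
  have : IsProbabilityMeasure η := Measure.isProbabilityMeasure_map hYm.aemeasurable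
  have hνi : Integrable (fun x => x) ν := by
    rw [hν, integrable_map_measure (by fun_prop) hYm.aemeasurable]; exact hic 1 n1
  have hηi : Integrable (fun x => x) η := by
    rw [hη, integrable_map_measure (by fun_prop) hYm.aemeasurable]; exact hic 0 n0
  have hηm : ∫ x, x ∂η = cexp μ Y {ω | D ω = 0 ∧ S ω = 1} := by
    rw [hη, integral_map hYm.aemeasurable (by fun_prop), ProbabilityTheory.cond,
      integral_smul_measure]
    unfold cexp pr
    rw [ENNReal.toReal_inv, smul_eq_mul, div_eq_inv_mul]
  have hFν : ∀ t, F1 t = (ν (Iic t)).toReal := by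
    intro t
    rw [hF1, hν, Measure.map_apply hYm measurableSet_Iic, cond_apply (mE 1), ENNReal.toReal_mul,
      ENNReal.toReal_inv, ← div_eq_inv_mul]
    rfl
  have hFq : ∀ r, 0 < r → r < 1 → F1 (yq r) = r := fun r h0 h1 => by
    rw [hyq]; exact LeeAux.quantile ν F1 hFν hF1cont hF1mono r h0 h1
  -- the law of the observables
  have mA : ∀ (A : Set ℝ), MeasurableSet A → ∀ d : ℝ, μ {ω | D ω = d ∧ S ω = 1} ≠ 0 →
      μ {ω | Y ω ∈ A ∧ S ω = 1 ∧ D ω = d} = μ {ω | D ω = d ∧ S ω = 1} *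
        Measure.map Y (μ[|{ω | D ω = d ∧ S ω = 1}]) A := by
    intro A hA d hd
    rw [Measure.map_apply hYm hA, cond_apply (mE d), ← mul_assoc,
      ENNReal.mul_inv_cancel hd (measure_ne_top _ _), one_mul]
    congr 1; ext ω; simp; tauto
  have mZ : ∀ (A : Set ℝ) (d : ℝ), μ {ω | Y ω ∈ A ∧ S ω = 0 ∧ D ω = d} =
      ENNReal.ofReal (pr μ {ω | D ω = d} - pr μ {ω | D ω = d ∧ S ω = 1}) * A.indicator 1 0 := by
    intro A d
    by_cases h0 : (0 : ℝ) ∈ A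
    · have e : {ω | Y ω ∈ A ∧ S ω = 0 ∧ D ω = d} =
          {ω | D ω = d} \ {ω | D ω = d ∧ S ω = 1} := by
        ext ω; rcases hSv ω with a | a <;> simp [hY, a, h0]
      have hsub : {ω | D ω = d ∧ S ω = 1} ⊆ {ω | D ω = d} := fun ω h => h.1
      have hd := measureReal_sdiff (μ := μ) hsub (mE d)
      rw [e, hpr, hpr, ← hd, ofReal_measureReal]
      simp [h0]
    · have e : {ω | Y ω ∈ A ∧ S ω = 0 ∧ D ω = d} = ∅ := by
        ext ω; rcases hSv ω with a | a <;> simp [hY, a, h0]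
      rw [e]; simp [h0]
  have v1 : μ {ω | D ω = 1 ∧ S ω = 1} = ENNReal.ofReal p * ENNReal.ofReal α1 := by
    rw [← ENNReal.ofReal_mul hD1.le, ← hE1, hpr, ofReal_measureReal]
  have v0 : μ {ω | D ω = 0 ∧ S ω = 1} = ENNReal.ofReal (1 - p) * ENNReal.ofReal α0 := by
    rw [← ENNReal.ofReal_mul (by linarith), ← hE0, hpr, ofReal_measureReal]
  have fin : ∀ (m σ : ℝ), σ * σ = 1 → (∀ a : ℝ, 0 ≤ a → f1 (m - σ * a) ≤ f1 (m + σ * a)) →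
      ν {x | σ * (x - m) ≤ 0} = ENNReal.ofReal (ϑ * q0 / 2) →
      ∃ c : SelectionConfig ϑL,
      Measure.map (fun ω => (c.Y' ω, c.S' ω, c.D' ω)) c.μ'
          = Measure.map (fun ω => (Y ω, S ω, D ω)) μ ∧
        cexp c.μ' (fun ω => c.Y1' ω - c.Y0' ω) {ω | c.S0' ω = 1 ∧ c.S1' ω = 1}
          = m - cexp μ Y {ω | D ω = 0 ∧ S ω = 1} := by
    intro m σ hσ htail hmass
    rw [hq0] at hmass
    obtain ⟨c, hcA, hcτ⟩ := LeeAux.core ϑL ϑ α0 α1 p α0pos α1pos hϑ0 hϑ1 hLϑ hD1.le hD1'.le h00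
      (by linarith) ν η hνi hηi f1 hf1 m σ hσ htail hmass
    refine ⟨c, ?_, by rw [hcτ, hηm]⟩
    have cS : Measurable c.S' := by
      rw [show c.S' = fun ω => c.S1' ω * c.D' ω + c.S0' ω * (1 - c.D' ω) from funext c.hS']
      have := c.meas_S1; have := c.meas_S0; have := c.meas_D
      fun_prop
    have cY : Measurable c.Y' := by
      rw [show c.Y' = fun ω => c.S' ω * (c.Y1' ω * c.D' ω + c.Y0' ω * (1 - c.D' ω)) from
        funext c.hY']
      have := c.meas_Y1; have := c.meas_Y0; have := c.meas_D
      fun_prop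
    have cSv : ∀ ω, c.S' ω = 0 ∨ c.S' ω = 1 := by
      intro ω
      rcases c.vals_S1 ω with a | a <;> rcases c.vals_S0 ω with b | b <;>
        rcases c.vals_D ω with d | d <;> simp [c.hS', a, b, d]
    refine LeeAux.law_eq μ c.μ' Y S D c.Y' c.S' c.D' hYm hSm hDm cY cS c.meas_D hSv hDv cSv
      c.vals_D ?_
    intro A hA s d hs hd
    obtain ⟨c1, c2, c3, c4⟩ := hcA A hA
    rcases hs with rfl | rfl <;> rcases hd with rfl | rfl
    · rw [c4, mZ, hD0, hE0, ← mul_assoc, ← ENNReal.ofReal_mul (by linarith)]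
      congr 2; ring
    · rw [c3, mZ, hE1, ← hp, ← mul_assoc, ← ENNReal.ofReal_mul hD1.le]
      congr 2; ring
    · rw [c2, mA A hA 0 n0, v0, mul_assoc]
    · rw [c1, mA A hA 1 n1, v1, mul_assoc]
  constructor
  · refine fin _ (-1) (by norm_num) (fun a ha => ?_) ?_
    · have := htailU a ha
      convert this using 2 <;> ring
    · set m := yq (1 - ϑ * q0 / 2) with hm
      have hac : ν ≪ volume := by rw [hf1]; exact withDensity_absolutelyContinuous _ _
      have e : {x : ℝ | -1 * (x - m) ≤ 0} = Ici m := by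
        ext x; simp
      have h0 : ν {m} = 0 := hac (by simp)
      have e2 : ν (Ici m) = ν (Ioi m) := by
        exact measure_congr (Ioi_ae_eq_Ici' h0).symm
      have hF := hFq (1 - ϑ * q0 / 2) (by linarith) (by linarith)
      rw [← hm, hFν] at hF
      rw [e, e2, ← compl_Iic, ← ofReal_measureReal, probReal_compl_eq_one_sub measurableSet_Iic]
      congr 1
      change 1 - (ν (Iic m)).toReal = _
      rw [hF]; ring
  · refine fin _ 1 (by norm_num) (fun a ha => ?_) ?_
    · simpa using htailL a ha
    · set m := yq (ϑ * q0 / 2) with hm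
      have e : {x : ℝ | 1 * (x - m) ≤ 0} = Iic m := by
        ext x; simp
      have hF := hFq (ϑ * q0 / 2) (by linarith) (by linarith)
      rw [← hm, hFν] at hF
      rw [e, ← hF, ENNReal.ofReal_toReal (measure_ne_top _ _)]

end
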